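/- Assume (H1) and let F be the operator defined in the context. Then the family {F(·,y) : y bounded} is equicontractive with constant 1/2: for all bounded functions x, z, y : [−r,τ] → ℝⁿ, sup_{t∈[−r,τ]} ‖F(z,y)(t) − F(x,y)(t)‖_{ℝⁿ} ≤ (N_q·q + L)·sup_{t∈[−r,τ]} ‖z(t) − x(t)‖_{ℝⁿ} ≤ (1/2)·sup_{t∈[−r,τ]} ‖z(t) − x(t)‖_{ℝⁿ}. -/

import Mathlib

open Matrix Set

/-- supremum of the norm of `w` over the interval `[a, b]`. -/
noncomputable def supOn {E : Type*} [NormedAddCommGroup E]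
    (a b : ℝ) (w : ℝ → E) : ℝ :=
  ⨆ u : Set.Icc a b, ‖w u.1‖

/-- `w` is bounded (in norm) on the interval `[a, b]`. -/
def BddOn {E : Type*} [NormedAddCommGroup E] (a b : ℝ) (w : ℝ → E) : Prop :=
  ∃ C : ℝ, ∀ u ∈ Set.Icc a b, ‖w u‖ ≤ C

theorem norm_le_supOn {E : Type*} [NormedAddCommGroup E] {a b : ℝ} {w : ℝ → E}
    (hw : BddOn a b w) {u : ℝ} (hu : u ∈ Set.Icc a b) : ‖w u‖ ≤ supOn a b w := by
  obtain ⟨C, hC⟩ := hw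
  have hbdd : BddAbove (Set.range fun v : Set.Icc a b => ‖w v.1‖) := by
    refine ⟨C, ?_⟩
    rintro _ ⟨v, rfl⟩
    exact hC v.1 v.2
  exact le_ciSup hbdd ⟨u, hu⟩

theorem supOn_nonneg {E : Type*} [NormedAddCommGroup E] (a b : ℝ) (w : ℝ → E) :
    0 ≤ supOn a b w :=
  Real.iSup_nonneg fun _ => norm_nonneg _

theorem supOn_le {E : Type*} [NormedAddCommGroup E] {a b M : ℝ} {w : ℝ → E}
    (hM : 0 ≤ M) (hw : ∀ u ∈ Set.Icc a b, ‖w u‖ ≤ M) : supOn a b w ≤ M :=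
  Real.iSup_le (fun u => hw u.1 u.2) hM

theorem BddOn.sub {E : Type*} [NormedAddCommGroup E] {a b : ℝ} {v w : ℝ → E}
    (hv : BddOn a b v) (hw : BddOn a b w) : BddOn a b (v - w) := by
  obtain ⟨C, hC⟩ := hv
  obtain ⟨D, hD⟩ := hw
  exact ⟨C + D, fun u hu => (norm_sub_le _ _).trans (add_le_add (hC u hu) (hD u hu))⟩

theorem exists_lt_mem_Ioc_succ {α : Type*} [LinearOrder α] (t : ℕ → α) {u : α} (h0 : t 0 < u) :
    ∀ k : ℕ, u ≤ t k → ∃ i < k, u ∈ Set.Ioc (t i) (t (i + 1))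
  | 0, h => absurd h0 h.not_gt
  | k + 1, h => by
    rcases le_or_gt u (t k) with hk | hk
    · obtain ⟨i, hi, hu⟩ := exists_lt_mem_Ioc_succ t h0 k hk
      exact ⟨i, hi.trans k.lt_succ_self, hu⟩
    · exact ⟨k, k.lt_succ_self, hk, h⟩

/-- Under (H1), the family `{F(·,y)}` is equicontractive with constant `1/2`:
`sup ‖F(z,y) − F(x,y)‖ ≤ (N_q·q + L)·sup ‖z − x‖ ≤ (1/2)·sup ‖z − x‖`. -/
theorem F_equicontractive
    (n N q : ℕ) (hn : 1 ≤ n)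
    (r τ : ℝ) (hr : 0 < r) (hτ : 0 < τ)
    (tt ss : ℕ → ℝ) (htt0 : tt 0 = 0) (hss0 : ss 0 = 0) (htt1 : 0 < tt 1)
    (hts : ∀ i ∈ Finset.Icc 1 N, tt i ≤ ss i ∧ ss i < tt (i + 1))
    (httN : tt (N + 1) = τ)
    (θ : ℕ → ℝ) (hθ : ∀ j ∈ Finset.Icc 1 q, 0 < θ j ∧ θ j < τ)
    (hθmono : ∀ j ∈ Finset.Icc 1 (q - 1), θ j < θ (j + 1))
    -- (H1)
    (Nq L : ℝ) (hNq : 0 < Nq) (hL : 0 < L) (hNqL : L + Nq * (q : ℝ) < 1 / 2)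
    (g : (Fin q → ℝ → (Fin n → ℝ)) → ℝ → (Fin n → ℝ))
    (hg0 : g (fun _ _ => 0) = fun _ => 0)
    (hglip : ∀ y z : Fin q → ℝ → (Fin n → ℝ), ∀ u ∈ Set.Icc (-r) (0 : ℝ),
      ‖g y u - g z u‖ ≤ Nq * ∑ j : Fin q, ‖y j u - z j u‖)
    (G : ℕ → ℝ → (Fin n → ℝ) → (Fin n → ℝ))
    (hG0 : ∀ i ∈ Finset.Icc 1 N, ∀ u : ℝ, G i u 0 = 0)
    (hGlip : ∀ i ∈ Finset.Icc 1 N, ∀ (u : ℝ) (x y : Fin n → ℝ),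
      ‖G i u x - G i u y‖ ≤ L * ‖x - y‖)
    -- data for F
    (φ : ℝ → (Fin n → ℝ)) (hφ : BddOn (-r) 0 φ)
    -- bounded inputs
    (x z y : ℝ → (Fin n → ℝ))
    (hx : BddOn (-r) τ x) (hz : BddOn (-r) τ z) (hy : BddOn (-r) τ y)
    -- `F(z,y)` and `F(x,y)`, characterized by the defining piecewise equations
    (Fzy Fxy : ℝ → (Fin n → ℝ))
    (hFzy1 : ∀ i ∈ Finset.Icc 0 N, ∀ u ∈ Set.Ioc (ss i) (tt (i + 1)), Fzy u = y u)
    (hFzy2 : ∀ i ∈ Finset.Icc 1 N, ∀ u ∈ Set.Ioc (tt i) (ss i),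
      Fzy u = G i u (z u))
    (hFzy3 : ∀ u ∈ Set.Icc (-r) (0 : ℝ),
      Fzy u = φ u - g (fun j w => z (θ (j.1 + 1) + w)) u)
    (hFxy1 : ∀ i ∈ Finset.Icc 0 N, ∀ u ∈ Set.Ioc (ss i) (tt (i + 1)), Fxy u = y u)
    (hFxy2 : ∀ i ∈ Finset.Icc 1 N, ∀ u ∈ Set.Ioc (tt i) (ss i),
      Fxy u = G i u (x u))
    (hFxy3 : ∀ u ∈ Set.Icc (-r) (0 : ℝ),
      Fxy u = φ u - g (fun j w => x (θ (j.1 + 1) + w)) u) :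
    supOn (-r) τ (Fzy - Fxy) ≤ (Nq * (q : ℝ) + L) * supOn (-r) τ (z - x) ∧
      (Nq * (q : ℝ) + L) * supOn (-r) τ (z - x) ≤ (1 / 2) * supOn (-r) τ (z - x) := by
  set S := supOn (-r) τ (z - x) with hS
  have hS0 : 0 ≤ S := supOn_nonneg _ _ _
  have hle : ∀ u ∈ Set.Icc (-r) τ, ‖z u - x u‖ ≤ S := fun u hu =>
    norm_le_supOn (hz.sub hx) hu
  have hq : 0 ≤ Nq * (q : ℝ) := by positivity
  refine ⟨supOn_le (by positivity) fun u hu => ?_,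
    mul_le_mul_of_nonneg_right (by linarith) hS0⟩
  rw [Pi.sub_apply]
  rcases le_or_gt u 0 with hu0 | hu0
  · have hu' : u ∈ Set.Icc (-r) (0 : ℝ) := ⟨hu.1, hu0⟩
    rw [hFzy3 u hu', hFxy3 u hu', sub_sub_sub_cancel_left]
    have hsum : ∑ j : Fin q, ‖x (θ (j.1 + 1) + u) - z (θ (j.1 + 1) + u)‖ ≤ q * S := by
      refine (Finset.sum_le_card_nsmul _ _ S fun j _ => ?_).trans_eq (by simp)
      obtain ⟨h1, h2⟩ := hθ (j.1 + 1) (Finset.mem_Icc.2 ⟨by omega, j.2⟩)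
      rw [norm_sub_rev]
      exact hle _ ⟨by linarith [hu.1], by linarith⟩
    calc _ ≤ Nq * ∑ j : Fin q, ‖x (θ (j.1 + 1) + u) - z (θ (j.1 + 1) + u)‖ :=
        hglip (fun j w => x (θ (j.1 + 1) + w)) (fun j w => z (θ (j.1 + 1) + w)) u hu'
      _ ≤ Nq * (q * S) := mul_le_mul_of_nonneg_left hsum hNq.le
      _ ≤ (Nq * q + L) * S := by nlinarith [mul_nonneg hL.le hS0]
  · obtain ⟨i, hi, hui⟩ :=
      exists_lt_mem_Ioc_succ tt (htt0.trans_lt hu0) (N + 1) (hu.2.trans_eq httN.symm)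
    have hiN : i ≤ N := Nat.lt_succ_iff.1 hi
    rcases lt_or_ge (ss i) u with hs | hs
    · have hi0 : i ∈ Finset.Icc 0 N := Finset.mem_Icc.2 ⟨i.zero_le, hiN⟩
      rw [hFzy1 i hi0 u ⟨hs, hui.2⟩, hFxy1 i hi0 u ⟨hs, hui.2⟩, sub_self, norm_zero]
      positivity
    · have hipos : 1 ≤ i := by
        rw [Nat.one_le_iff_ne_zero]
        rintro rfl
        linarith
      have hi1 : i ∈ Finset.Icc 1 N := Finset.mem_Icc.2 ⟨hipos, hiN⟩
      rw [hFzy2 i hi1 u ⟨hui.1, hs⟩, hFxy2 i hi1 u ⟨hui.1, hs⟩]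
      calc _ ≤ L * ‖z u - x u‖ := hGlip i hi1 u _ _
        _ ≤ L * S := mul_le_mul_of_nonneg_left (hle u hu) hL.le
        _ ≤ (Nq * q + L) * S := mul_le_mul_of_nonneg_right (by linarith) hS0
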